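/- Let ν > η > 0 and μ := √(ν² − η²). Then for every x > x#_{μ,η}, 16x⁴(x² − μ²)⁶·(ψlo'_{ν,η}(x))²·(V_{ψlo_{ν,η}}(x) − (1 − (ν² − 1/4)/x² + 2(1 − η)/(x² − μ²) − 3x²/(x² − μ²)²)) = r_{μ,η}(x). -/

import Mathlib

/-- The potential `V_f` associated with a function `f` via Liouville's transformation. -/
noncomputable def potential (f : ℝ → ℝ) (x : ℝ) : ℝ :=
  (deriv f x) ^ 2 + (1 / 2) * (deriv (deriv (deriv f)) x / deriv f x)
    - (3 / 4) * (deriv (deriv f) x / deriv f x) ^ 2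

/-- The lower bound for the phase of ultraspherical Bessel derivatives: for `μ = √(ν² − η²)`,
`ψlo_{ν,η}(x) := √(x² − μ²) − (η²/(2μ) + μ)·arccos(μ/x) + η/√(x² − μ²)
  + (π/4)(η²/μ + 2(μ − ν) + 1)`. -/
noncomputable def psiLo (ν η x : ℝ) : ℝ :=
  Real.sqrt (x ^ 2 - Real.sqrt (ν ^ 2 - η ^ 2) ^ 2)
    - (η ^ 2 / (2 * Real.sqrt (ν ^ 2 - η ^ 2)) + Real.sqrt (ν ^ 2 - η ^ 2))
      * Real.arccos (Real.sqrt (ν ^ 2 - η ^ 2) / x)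
    + η / Real.sqrt (x ^ 2 - Real.sqrt (ν ^ 2 - η ^ 2) ^ 2)
    + (Real.pi / 4) * (η ^ 2 / Real.sqrt (ν ^ 2 - η ^ 2)
      + 2 * (Real.sqrt (ν ^ 2 - η ^ 2) - ν) + 1)

/-- `x#_{μ,η} := (1/2)·√(4μ² + η(η + 2) + √(η²(η + 2)² + 16μ²η))`. -/
noncomputable def xSharp (μ η : ℝ) : ℝ :=
  (1 / 2) * Real.sqrt (4 * μ ^ 2 + η * (η + 2)
    + Real.sqrt (η ^ 2 * (η + 2) ^ 2 + 16 * μ ^ 2 * η))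

/-- The polynomial `r_{μ,η}(x)` from the paper. -/
noncomputable def rPoly (μ η x : ℝ) : ℝ :=
  12 * x ^ 14
  + x ^ 12 * (-44 * μ ^ 2 + 4 * η * (η ^ 3 + 4 * η ^ 2 - 5 * η - 18))
  + x ^ 10 * (40 * μ ^ 4 + 8 * η * (-3 * η ^ 3 - 10 * η ^ 2 + 6 * η + 5) * μ ^ 2
      - η ^ 2 * (η + 2) ^ 2 * (4 * η ^ 2 + 8 * η - 3))
  + x ^ 8 * (40 * μ ^ 6 + 4 * η * (15 * η ^ 3 + 40 * η ^ 2 + 2 * η + 70) * μ ^ 4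
      + η ^ 2 * (20 * η ^ 4 + 96 * η ^ 3 + 147 * η ^ 2 + 96 * η + 52) * μ ^ 2
      + η ^ 4 * (η + 2) ^ 4)
  + x ^ 6 * (-100 * μ ^ 8 - 8 * η * (10 * η ^ 3 + 20 * η ^ 2 + 14 * η + 45) * μ ^ 6
      - η ^ 2 * (40 * η ^ 4 + 144 * η ^ 3 + 171 * η ^ 2 + 116 * η + 80) * μ ^ 4
      - 4 * η ^ 5 * (η + 2) ^ 3 * μ ^ 2)
  + x ^ 4 * (68 * μ ^ 10 + 4 * η * (15 * η ^ 3 + 20 * η ^ 2 + 27 * η + 20) * μ ^ 8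
      + η ^ 2 * (40 * η ^ 4 + 96 * η ^ 3 + 81 * η ^ 2 + 24 * η + 16) * μ ^ 6
      + 6 * η ^ 6 * (η + 2) ^ 2 * μ ^ 4)
  + x ^ 2 * (-16 * μ ^ 12 - 8 * η * (3 * η ^ 3 + 2 * η ^ 2 + 4 * η - 4) * μ ^ 10
      - 4 * η ^ 3 * (5 * η ^ 3 + 6 * η ^ 2 + 3 * η - 4) * μ ^ 8
      - 4 * η ^ 7 * (η + 2) * μ ^ 6)
  + (4 * η ^ 4 * μ ^ 12 + 4 * η ^ 6 * μ ^ 10 + η ^ 8 * μ ^ 8)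

/-- For `0 ≤ μ < x`, the quantity `x² − μ²` is positive. -/
lemma sq_sub_sq_pos_of_lt {μ x : ℝ} (hμ : 0 ≤ μ) (hx : μ < x) : 0 < x ^ 2 - μ ^ 2 := by
  nlinarith

lemma hasDerivAt_sqrt_sq_sub_sq {μ x : ℝ} (h : 0 < x ^ 2 - μ ^ 2) :
    HasDerivAt (fun y : ℝ => Real.sqrt (y ^ 2 - μ ^ 2)) (x / Real.sqrt (x ^ 2 - μ ^ 2)) x := by
  have h1 : HasDerivAt (fun y : ℝ => y ^ 2 - μ ^ 2) (2 * x) x := by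
    simpa using (hasDerivAt_pow 2 x).sub_const (μ ^ 2)
  refine (h1.sqrt h.ne').congr_deriv ?_
  ring

lemma hasDerivAt_arccos_div {μ x : ℝ} (hμ : 0 < μ) (hx : μ < x) :
    HasDerivAt (fun y : ℝ => Real.arccos (μ / y)) (μ / (x * Real.sqrt (x ^ 2 - μ ^ 2))) x := by
  have hx0 : 0 < x := hμ.trans hx
  have hs : 0 < Real.sqrt (x ^ 2 - μ ^ 2) := Real.sqrt_pos.2 (sq_sub_sq_pos_of_lt hμ.le hx)
  have hlt : μ / x < 1 := (div_lt_one hx0).2 hx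
  have hpos : 0 < μ / x := div_pos hμ hx0
  have h1 : HasDerivAt (fun y : ℝ => μ / y) (-μ / x ^ 2) x := by
    simpa using (hasDerivAt_const x μ).fun_div (hasDerivAt_id' x) hx0.ne'
  have h2 := (Real.hasDerivAt_arccos (by linarith) hlt.ne).comp x h1
  have h3 : Real.sqrt (1 - (μ / x) ^ 2) = Real.sqrt (x ^ 2 - μ ^ 2) / x := by
    rw [show 1 - (μ / x) ^ 2 = (x ^ 2 - μ ^ 2) / x ^ 2 by field_simp,
      Real.sqrt_div' _ (sq_nonneg x), Real.sqrt_sq hx0.le]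
  rw [h3] at h2
  refine h2.congr_deriv ?_
  field_simp

/-- Differentiation of functions of the form `A(x) / (x ^ k (x² − μ²) ^ m √(x² − μ²))`. -/
lemma hasDerivAt_div_pow_mul_sqrt {μ x a : ℝ} {A : ℝ → ℝ} (k m : ℕ) (hx : 0 < x)
    (hs : 0 < x ^ 2 - μ ^ 2) (hA : HasDerivAt A a x) :
    HasDerivAt
      (fun y => A y / (y ^ k * (y ^ 2 - μ ^ 2) ^ m * Real.sqrt (y ^ 2 - μ ^ 2)))
      ((a * x * (x ^ 2 - μ ^ 2) - k * (x ^ 2 - μ ^ 2) * A x - (2 * m + 1) * x ^ 2 * A x)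
        / (x ^ (k + 1) * (x ^ 2 - μ ^ 2) ^ (m + 1) * Real.sqrt (x ^ 2 - μ ^ 2))) x := by
  have hw : 0 < Real.sqrt (x ^ 2 - μ ^ 2) := Real.sqrt_pos.2 hs
  have hsq : Real.sqrt (x ^ 2 - μ ^ 2) ^ 2 = x ^ 2 - μ ^ 2 := Real.sq_sqrt hs.le
  have h1 : HasDerivAt (fun y : ℝ => y ^ 2 - μ ^ 2) (2 * x) x := by
    simpa using (hasDerivAt_pow 2 x).sub_const (μ ^ 2)
  have hpk : (k : ℝ) * x ^ (k - 1) = k * x ^ k / x := by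
    rcases k with _ | k
    · simp
    · field_simp; simp [pow_succ]
  have hpm : (m : ℝ) * (x ^ 2 - μ ^ 2) ^ (m - 1)
      = m * (x ^ 2 - μ ^ 2) ^ m / (x ^ 2 - μ ^ 2) := by
    rcases m with _ | m
    · simp
    · rw [eq_div_iff hs.ne', mul_assoc, Nat.add_sub_cancel, ← pow_succ]
  have hne : x ^ k * (x ^ 2 - μ ^ 2) ^ m * Real.sqrt (x ^ 2 - μ ^ 2) ≠ 0 := by positivity
  have h2 := hA.fun_div
    (((hasDerivAt_pow k x).fun_mul (h1.fun_pow m)).fun_mul (hasDerivAt_sqrt_sq_sub_sq hs)) hne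
  refine h2.congr_deriv ?_
  rw [hpk, hpm]
  set s := x ^ 2 - μ ^ 2
  set w := Real.sqrt s
  rw [← hsq]
  field_simp
  ring

/-- The numerator of `ψlo'`, namely `(x² − μ²)² − (η²/2)(x² − μ²) − ηx²`. -/
noncomputable def derivNum (μ η x : ℝ) : ℝ :=
  (x ^ 2 - μ ^ 2) ^ 2 - η ^ 2 / 2 * (x ^ 2 - μ ^ 2) - η * x ^ 2

lemma hasDerivAt_derivNum (μ η x : ℝ) :
    HasDerivAt (derivNum μ η) (4 * x * (x ^ 2 - μ ^ 2) - η ^ 2 * x - 2 * η * x) x := by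
  have h1 : HasDerivAt (fun y : ℝ => y ^ 2 - μ ^ 2) (2 * x) x := by
    simpa using (hasDerivAt_pow 2 x).sub_const (μ ^ 2)
  refine (((h1.fun_pow 2).fun_sub (h1.const_mul (η ^ 2 / 2))).fun_sub
    ((hasDerivAt_pow 2 x).const_mul η)).congr_deriv ?_
  push_cast
  ring

/-- The numerator of `ψlo''`. -/
noncomputable def derivNum₂ (μ η x : ℝ) : ℝ :=
  (4 * x * (x ^ 2 - μ ^ 2) - η ^ 2 * x - 2 * η * x) * x * (x ^ 2 - μ ^ 2)
    - (x ^ 2 - μ ^ 2) * derivNum μ η x - 3 * x ^ 2 * derivNum μ η x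

/-- The derivative of `derivNum₂`. -/
noncomputable def derivNum₂Deriv (μ η x : ℝ) : ℝ :=
  (12 * x ^ 2 - 4 * μ ^ 2 - η ^ 2 - 2 * η) * x * (x ^ 2 - μ ^ 2)
    + (4 * x * (x ^ 2 - μ ^ 2) - η ^ 2 * x - 2 * η * x) * (3 * x ^ 2 - μ ^ 2)
    - 8 * x * derivNum μ η x
    - (4 * x ^ 2 - μ ^ 2) * (4 * x * (x ^ 2 - μ ^ 2) - η ^ 2 * x - 2 * η * x)

lemma hasDerivAt_derivNum₂ (μ η x : ℝ) :
    HasDerivAt (derivNum₂ μ η) (derivNum₂Deriv μ η x) x := by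
  have h1 : HasDerivAt (fun y : ℝ => y ^ 2 - μ ^ 2) (2 * x) x := by
    simpa using (hasDerivAt_pow 2 x).sub_const (μ ^ 2)
  have h2 : HasDerivAt (fun y : ℝ => 4 * y * (y ^ 2 - μ ^ 2) - η ^ 2 * y - 2 * η * y)
      (12 * x ^ 2 - 4 * μ ^ 2 - η ^ 2 - 2 * η) x := by
    refine (((((hasDerivAt_id' x).const_mul 4).fun_mul h1).fun_sub
      ((hasDerivAt_id' x).const_mul (η ^ 2))).fun_sub
      ((hasDerivAt_id' x).const_mul (2 * η))).congr_deriv ?_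
    ring
  have hP := hasDerivAt_derivNum μ η x
  refine ((((h2.fun_mul (hasDerivAt_id' x)).fun_mul h1).fun_sub (h1.fun_mul hP)).fun_sub
    (((hasDerivAt_pow 2 x).const_mul 3).fun_mul hP)).congr_deriv ?_
  simp only [derivNum₂Deriv]
  push_cast
  ring

/-- Beyond `x#` we are beyond the singularity `μ`, and the derivative of `ψlo` is positive. -/
lemma lt_and_derivNum_pos_of_xSharp_lt {μ η x : ℝ} (hη : 0 < η)
    (hx : xSharp μ η < x) : μ < x ∧ 0 < derivNum μ η x := by
  set D := Real.sqrt (η ^ 2 * (η + 2) ^ 2 + 16 * μ ^ 2 * η) with hD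
  have hD0 : 0 ≤ D := Real.sqrt_nonneg _
  have hDsq : D ^ 2 = η ^ 2 * (η + 2) ^ 2 + 16 * μ ^ 2 * η := Real.sq_sqrt (by positivity)
  have hx0 : 0 ≤ xSharp μ η := by unfold xSharp; positivity
  have hsq : xSharp μ η ^ 2 = (4 * μ ^ 2 + η * (η + 2) + D) / 4 := by
    rw [xSharp, mul_pow, Real.sq_sqrt (by positivity)]
    ring
  have hlt : (4 * μ ^ 2 + η * (η + 2) + D) / 4 < x ^ 2 := hsq ▸ pow_lt_pow_left₀ hx hx0 two_ne_zero
  have hη2 : 0 < η * (η + 2) := by positivity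
  refine ⟨lt_of_pow_lt_pow_left₀ 2 (hx0.trans hx.le) (by linarith), ?_⟩
  have h1 : 0 < x ^ 2 - μ ^ 2 - (η * (η + 2) + D) / 4 := by linarith
  have h2 : 0 < x ^ 2 - μ ^ 2 - (η * (η + 2) - D) / 4 := by linarith
  have h3 : derivNum μ η x = (x ^ 2 - μ ^ 2 - (η * (η + 2) + D) / 4)
      * (x ^ 2 - μ ^ 2 - (η * (η + 2) - D) / 4) := by
    unfold derivNum
    linear_combination (1 / 16) * hDsq
  rw [h3]
  exact mul_pos h1 h2

lemma deriv_psiLo {ν η x : ℝ} (hη : 0 < η) (hν : η < ν) (hx : Real.sqrt (ν ^ 2 - η ^ 2) < x) :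
    deriv (psiLo ν η) x = derivNum (Real.sqrt (ν ^ 2 - η ^ 2)) η x
      / (x ^ 1 * (x ^ 2 - Real.sqrt (ν ^ 2 - η ^ 2) ^ 2) ^ 1
        * Real.sqrt (x ^ 2 - Real.sqrt (ν ^ 2 - η ^ 2) ^ 2)) := by
  have hμ : 0 < Real.sqrt (ν ^ 2 - η ^ 2) := Real.sqrt_pos.2 (sq_sub_sq_pos_of_lt hη.le hν)
  unfold psiLo
  set μ := Real.sqrt (ν ^ 2 - η ^ 2)
  have hx0 : 0 < x := hμ.trans hx
  have hs := sq_sub_sq_pos_of_lt hμ.le hx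
  have hw : 0 < Real.sqrt (x ^ 2 - μ ^ 2) := Real.sqrt_pos.2 hs
  have hsq : Real.sqrt (x ^ 2 - μ ^ 2) ^ 2 = x ^ 2 - μ ^ 2 := Real.sq_sqrt hs.le
  have hsqrt := hasDerivAt_sqrt_sq_sub_sq hs
  have h := (((hsqrt.fun_sub
    ((hasDerivAt_arccos_div hμ hx).const_mul (η ^ 2 / (2 * μ) + μ))).fun_add
    ((hasDerivAt_const x η).fun_div hsqrt hw.ne')).add_const
    ((Real.pi / 4) * (η ^ 2 / μ + 2 * (μ - ν) + 1)))
  rw [h.deriv, derivNum]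
  generalize Real.sqrt (x ^ 2 - μ ^ 2) = w at hw hsq ⊢
  rw [← hsq]
  field_simp
  linear_combination (-2) * w ^ 2 * hsq

/-- The key algebraic identity: for `ν > η > 0`, `μ = √(ν² − η²)`, and `x > x#_{μ,η}`,
`16x⁴(x² − μ²)⁶·(ψlo'_{ν,η}(x))²·(V_{ψlo_{ν,η}}(x) − (1 − (ν² − 1/4)/x²
  + 2(1 − η)/(x² − μ²) − 3x²/(x² − μ²)²)) = r_{μ,η}(x)`. -/
theorem psiLo_potential_identity (ν η : ℝ) (hη : 0 < η) (hν : η < ν) :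
    ∀ x, xSharp (Real.sqrt (ν ^ 2 - η ^ 2)) η < x →
      16 * x ^ 4 * (x ^ 2 - Real.sqrt (ν ^ 2 - η ^ 2) ^ 2) ^ 6
        * (deriv (psiLo ν η) x) ^ 2
        * (potential (psiLo ν η) x
          - (1 - (ν ^ 2 - 1 / 4) / x ^ 2
            + 2 * (1 - η) / (x ^ 2 - Real.sqrt (ν ^ 2 - η ^ 2) ^ 2)
            - 3 * x ^ 2 / (x ^ 2 - Real.sqrt (ν ^ 2 - η ^ 2) ^ 2) ^ 2))
      = rPoly (Real.sqrt (ν ^ 2 - η ^ 2)) η x := by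
  intro x hx
  have hμ : 0 < Real.sqrt (ν ^ 2 - η ^ 2) := Real.sqrt_pos.2 (sq_sub_sq_pos_of_lt hη.le hν)
  have hν2 : ν ^ 2 = Real.sqrt (ν ^ 2 - η ^ 2) ^ 2 + η ^ 2 := by
    rw [Real.sq_sqrt (sq_sub_sq_pos_of_lt hη.le hν).le]
    ring
  have hd1 := fun y => deriv_psiLo (x := y) hη hν
  rw [show ν ^ 2 - 1 / 4 = Real.sqrt (ν ^ 2 - η ^ 2) ^ 2 + η ^ 2 - 1 / 4 by rw [← hν2]]
  generalize Real.sqrt (ν ^ 2 - η ^ 2) = μ at *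
  obtain ⟨hμx, hP⟩ := lt_and_derivNum_pos_of_xSharp_lt hη hx
  have hd2 : ∀ y, μ < y → deriv (deriv (psiLo ν η)) y = derivNum₂ μ η y
      / (y ^ 2 * (y ^ 2 - μ ^ 2) ^ 2 * Real.sqrt (y ^ 2 - μ ^ 2)) := by
    intro y hy
    have he : deriv (psiLo ν η) =ᶠ[nhds y] _ := (eventually_gt_nhds hy).mono hd1
    rw [he.deriv_eq, (hasDerivAt_div_pow_mul_sqrt 1 1 (hμ.trans hy)
      (sq_sub_sq_pos_of_lt hμ.le hy) (hasDerivAt_derivNum μ η y)).deriv, derivNum₂]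
    norm_num
  have hd3 : deriv (deriv (deriv (psiLo ν η))) x =
      (derivNum₂Deriv μ η x * x * (x ^ 2 - μ ^ 2) - 2 * (x ^ 2 - μ ^ 2) * derivNum₂ μ η x
        - 5 * x ^ 2 * derivNum₂ μ η x)
      / (x ^ 3 * (x ^ 2 - μ ^ 2) ^ 3 * Real.sqrt (x ^ 2 - μ ^ 2)) := by
    have he : deriv (deriv (psiLo ν η)) =ᶠ[nhds x] _ := (eventually_gt_nhds hμx).mono hd2
    rw [he.deriv_eq, (hasDerivAt_div_pow_mul_sqrt 2 2 (hμ.trans hμx)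
      (sq_sub_sq_pos_of_lt hμ.le hμx) (hasDerivAt_derivNum₂ μ η x)).deriv]
    norm_num
  have hx0 : 0 < x := hμ.trans hμx
  have hs := sq_sub_sq_pos_of_lt hμ.le hμx
  have hw : 0 < Real.sqrt (x ^ 2 - μ ^ 2) := Real.sqrt_pos.2 hs
  have hsq : Real.sqrt (x ^ 2 - μ ^ 2) ^ 2 = x ^ 2 - μ ^ 2 := Real.sq_sqrt hs.le
  rw [potential, hd3, hd2 x hμx, hd1 x hμx]
  have hclear : ∀ {s w P Q R N : ℝ}, 0 < s → 0 < w → w ^ 2 = s → 0 < P →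
      16 * x ^ 4 * s ^ 6 * (P / (x ^ 1 * s ^ 1 * w)) ^ 2
        * ((P / (x ^ 1 * s ^ 1 * w)) ^ 2
          + 1 / 2 * (R / (x ^ 3 * s ^ 3 * w) / (P / (x ^ 1 * s ^ 1 * w)))
          - 3 / 4 * (Q / (x ^ 2 * s ^ 2 * w) / (P / (x ^ 1 * s ^ 1 * w))) ^ 2
          - (1 - N / x ^ 2 + 2 * (1 - η) / s - 3 * x ^ 2 / s ^ 2))
      = 16 * P ^ 4 + 8 * s * P * R - 12 * s * Q ^ 2
        - 16 * P ^ 2 * s * (x ^ 2 * s ^ 2 - N * s ^ 2 + 2 * (1 - η) * x ^ 2 * s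
          - 3 * x ^ 4) := by
    intro s w P Q R N hs hw hws hP
    subst hws
    field_simp
    ring
  rw [hclear hs hw hsq hP]
  simp only [derivNum₂, derivNum₂Deriv, derivNum, rPoly]
  ring
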